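/- arXiv:1702.06115 — 2 statements merged into one kernel-verified Lean document; each statement's English description precedes it below -/
import Mathlib

section
/- Let G be a countable group, A ⊆ G a finite subset, and ρ a unitary representation of G on a Hilbert space H with κ_A(ρ, 𝟙) ≥ κ for some κ > 0; set κ₁ = √(1 − κ²/16). Let 0 < ε < 1 and let B ⊆ G be a finite set containing the identity such that every nonempty finite E ⊆ G has some b ∈ B with #(E ∩ E·b) ≤ ε·#E. Then for every f ∈ H and every n ≥ 1 there exists a finite set Eₙ ⊆ G such that: (1) ‖Σ_{g∈Eₙ} ρ(g)f‖ ≤ (2κ₁)ⁿ ‖f‖; (2) #Eₙ ≥ (2(1−ε))ⁿ; and (3) every element of Eₙ is a product of at most 2n elements of A ∪ B. -/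
open Filter

noncomputable section

namespace CriticalExponents

/-! ### One-sided subshifts of finite type -/

/-- The one-sided shift space of the zero-one transition matrix `A` over the alphabet `W`. -/
def SftSpace {W : Type*} (A : W → W → Bool) : Type _ :=
  {x : ℕ → W // ∀ i : ℕ, A (x i) (x (i + 1)) = true}

/-- The shift map `σ` on the one-sided shift space. -/
def shift {W : Type*} {A : W → W → Bool} (x : SftSpace A) : SftSpace A :=
  ⟨fun i => x.1 (i + 1), fun i => x.2 (i + 1)⟩

/-- Aperiodicity of the transition matrix: some power of `A` has all entries positive.
This is equivalent to the shift being topologically mixing. -/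
def Aperiodic {W : Type*} (A : W → W → Bool) : Prop :=
  ∃ N : ℕ, 0 < N ∧ ∀ i j : W, ∃ w : ℕ → W,
    w 0 = i ∧ w N = j ∧ ∀ t, t < N → A (w t) (w (t + 1)) = true

/-- Birkhoff sums `rⁿ(x) = Σ_{i<n} r(σⁱ x)`. -/
def birkhoff {W : Type*} {A : W → W → Bool} (r : SftSpace A → ℝ) (n : ℕ)
    (x : SftSpace A) : ℝ :=
  ∑ i ∈ Finset.range n, r (shift^[i] x)

/-- `r` is Lipschitz with constant `C` with respect to the metric
`d_θ(x,y) = θ^(min{i : xᵢ ≠ yᵢ})`: if `x` and `y` agree on their first `n` coordinates then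
`|r x - r y| ≤ C θ^n`.  (This is the notion of Hölder continuity used throughout.) -/
def HolderWith {W : Type*} {A : W → W → Bool} (θ C : ℝ) (r : SftSpace A → ℝ) : Prop :=
  ∀ (n : ℕ) (x y : SftSpace A), (∀ i, i < n → x.1 i = y.1 i) → |r x - r y| ≤ C * θ ^ n

/-- The supremum norm `‖f‖_∞`. -/
def supNorm {W : Type*} {A : W → W → Bool} (f : SftSpace A → ℝ) : ℝ :=
  ⨆ x : SftSpace A, |f x|

/-- The Lipschitz seminorm `|f|_θ` with respect to `d_θ`. -/
def holderSeminorm {W : Type*} {A : W → W → Bool} (θ : ℝ) (f : SftSpace A → ℝ) : ℝ :=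
  ⨆ n : ℕ, ⨆ q : {p : SftSpace A × SftSpace A // ∀ i, i < n → p.1.1 i = p.2.1 i},
    |f q.1.1 - f q.1.2| / θ ^ n

/-- The norm `‖f‖_θ = ‖f‖_∞ + |f|_θ`. -/
def thetaNorm {W : Type*} {A : W → W → Bool} (θ : ℝ) (f : SftSpace A → ℝ) : ℝ :=
  supNorm f + holderSeminorm θ f

/-- The ordered product `ψⁿ(x) = ψ(x₀)ψ(x₁)⋯ψ(x_{n-1})`. -/
def psiProd {W G : Type*} [Group G] (ψ : W → G) (n : ℕ) (x : ℕ → W) : G :=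
  ((List.range n).map fun i => ψ (x i)).prod

/-- The pressure `P(r,σ) = lim (1/n) log Σ_{σⁿx=x} e^{rⁿ(x)}` (as a `limsup`). -/
def pressure {W : Type*} {A : W → W → Bool} (r : SftSpace A → ℝ) : ℝ :=
  limsup (fun n : ℕ =>
    Real.log (∑' x : {x : SftSpace A // shift^[n] x = x}, Real.exp (birkhoff r n x.1)) / n)
    atTop

/-- The Gurevič pressure of `r` for the group extension by `ψ_H`:
`P_Gur(r, T_{ψ_H}) = limsup (1/n) log Σ{ e^{rⁿ(x)} : σⁿx = x, ψⁿ_H(x) = 1 }`. -/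
def gurevicPressure {W G : Type*} [Group G] {A : W → W → Bool}
    (r : SftSpace A → ℝ) (ψ : W → G) (H : Subgroup G) (hH : H.Normal) : ℝ :=
  limsup (fun n : ℕ =>
    Real.log (∑' x : {x : SftSpace A //
        shift^[n] x = x ∧ (QuotientGroup.mk (psiProd ψ n x.1) : G ⧸ H) = 1},
      Real.exp (birkhoff r n x.1)) / n) atTop

/-! ### ℓ²(G/H) and Kazhdan distances -/

/-- The ℓ²-norm of a real-valued function. -/
def l2norm {α : Type*} (f : α → ℝ) : ℝ :=
  Real.sqrt (∑' a : α, f a ^ 2)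

/-- The right regular representation of `G` on functions on `G/H`:
`(ρ_H(g) f)(xH) = f(xgH)`. -/
def rho {G : Type*} [Group G] (H : Subgroup G) (hH : H.Normal) (g : G)
    (f : G ⧸ H → ℝ) : G ⧸ H → ℝ :=
  fun q => f (q * QuotientGroup.mk g)

/-- The Kazhdan distance `κ_S(ρ_H, 𝟙)` between the representation `ρ_H` of `G` on `ℓ²(G/H)`
and the trivial representation. -/
def kazhdanDistQuot {G : Type*} [Group G] (H : Subgroup G) (hH : H.Normal)
    (S : Finset G) : ℝ :=
  sInf {c : ℝ | ∃ f : G ⧸ H → ℝ, l2norm f = 1 ∧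
    c = ⨆ a ∈ S, l2norm fun q => rho H hH a f q - f q}

/-- The Kazhdan distance `κ_S(ρ, 𝟙)` for a unitary representation `ρ` of `G` on a real
Hilbert space `E`. -/
def kazhdanDistRep {G E : Type*} [Group G] [NormedAddCommGroup E] [InnerProductSpace ℝ E]
    (ρ : G →* (E ≃ₗᵢ[ℝ] E)) (S : Finset G) : ℝ :=
  sInf {c : ℝ | ∃ v : E, ‖v‖ = 1 ∧ c = ⨆ a ∈ S, ‖ρ a v - v‖}

/-- The random walk operator `M_H = Σ_g μ(g) ρ_H(g)` on functions on `G/H`,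
for a measure `μ` supported on `B`. -/
def MHop {G : Type*} [Group G] (H : Subgroup G) (hH : H.Normal) (μ : G → ℝ)
    (B : Finset G) (f : G ⧸ H → ℝ) : G ⧸ H → ℝ :=
  fun q => ∑ g ∈ B, μ g * f (q * QuotientGroup.mk g)

/-! ### Transfer operators -/

/-- Prepend a letter to a sequence. -/
def consSeq {W : Type*} (a : W) (x : ℕ → W) : ℕ → W
  | 0 => a
  | n + 1 => x n

/-- Prepend an admissible letter to a point of the shift space; this enumerates the preimages
of `x` under the shift. -/
def cons {W : Type*} {A : W → W → Bool} (a : W) (x : SftSpace A)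
    (h : A a (x.1 0) = true) : SftSpace A :=
  ⟨consSeq a x.1, fun i => by
    cases i with
    | zero => exact h
    | succ n => exact x.2 n⟩

/-- The transfer operator `L_r f (x) = Σ_{σy=x} e^{r(y)} f(y)`. -/
def transferOp {W : Type*} [Fintype W] {A : W → W → Bool} (r : SftSpace A → ℝ)
    (f : SftSpace A → ℝ) : SftSpace A → ℝ :=
  fun x => ∑ a : W, if h : A a (x.1 0) = true then
    Real.exp (r (cons a x h)) * f (cons a x h) else 0

/-- The group extended transfer operator
`L_{r,H} f (x,g) = Σ_{σy=x} e^{r(y)} f(y, g ψ_H(y))`. -/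
def transferOpExt {W G : Type*} [Fintype W] [Group G] {A : W → W → Bool}
    (H : Subgroup G) (hH : H.Normal) (r : SftSpace A → ℝ) (ψ : W → G)
    (f : SftSpace A × (G ⧸ H) → ℝ) : SftSpace A × (G ⧸ H) → ℝ :=
  fun p => ∑ a : W, if h : A a (p.1.1 0) = true then
    Real.exp (r (cons a p.1 h)) * f (cons a p.1 h, p.2 * QuotientGroup.mk (ψ a)) else 0

/-- The norm of the Banach space `C^∞_H`:
`‖f‖ = sqrt( Σ_{g ∈ G/H} (sup_x |f(x,g)|)² )`. -/
def cinftyNorm {W G : Type*} [Group G] {A : W → W → Bool} (H : Subgroup G)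
    (f : SftSpace A × (G ⧸ H) → ℝ) : ℝ :=
  Real.sqrt (∑' g : G ⧸ H, (⨆ x : SftSpace A, |f (x, g)|) ^ 2)

/-- The operator norm of `T` with respect to the norm `Nrm`. -/
def opNormOn {V : Type*} (Nrm : V → ℝ) (T : V → V) : ℝ :=
  sSup ((fun f => Nrm (T f)) '' {f : V | Nrm f ≤ 1})

/-- The spectral radius of `T`, via the Gelfand formula `spr T = lim ‖Tⁿ‖^(1/n)`. -/
def sprOn {V : Type*} (Nrm : V → ℝ) (T : V → V) : ℝ :=
  limsup (fun n : ℕ => (opNormOn Nrm (T^[n])) ^ ((n : ℝ)⁻¹)) atTop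

/-- The sum `Σ_{σⁿ y = z} e^{rⁿ(y)} ρ_H(ψⁿ(y)) f ∈ ℓ²(G/H)`. -/
def extSum {W G : Type*} [Group G] {A : W → W → Bool} (H : Subgroup G) (hH : H.Normal)
    (r : SftSpace A → ℝ) (ψ : W → G) (n : ℕ) (z : SftSpace A) (f : G ⧸ H → ℝ) :
    G ⧸ H → ℝ :=
  fun q => ∑' y : {y : SftSpace A // shift^[n] y = z},
    Real.exp (birkhoff r n y.1) * f (q * QuotientGroup.mk (psiProd ψ n y.1.1))

/-! ### Linear visibility with remainder and weak symmetry -/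

/-- `(Σ⁺, G, ψ)` satisfies linear visibility with remainder (LVR). -/
def LVR {W G : Type*} [Group G] (A : W → W → Bool) (ψ : W → G) : Prop :=
  ∃ (len : G → ℕ) (chi : (g : G) → Fin (len g) → W),
    (∀ g, 1 ≤ len g) ∧
    (∀ (g : G) (i : ℕ) (h : i + 1 < len g),
      A (chi g ⟨i, Nat.lt_of_succ_lt h⟩) (chi g ⟨i + 1, h⟩) = true) ∧
    (∃ R : Finset G, ∀ g : G, ∃ r₁ ∈ R, ∃ r₂ ∈ R,
      (List.ofFn fun i => ψ (chi g i)).prod = r₁ * g * r₂) ∧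
    ∃ L : ℝ, 0 < L ∧ ∀ l : List G, (len l.prod : ℝ) ≤ L * ((l.map len).sum : ℕ)

/-- The involution `dag` of the alphabet is weakly symmetric with respect to `r`, witnessed by
the constants `D n`: for every admissible word `w` of length `n`, every `x ∈ [w]` and every
`y ∈ [w†]` we have `e^{rⁿ(x) - rⁿ(y)} ≤ D n`. -/
def DaggerWeaklySymm {W : Type*} {A : W → W → Bool} (dag : W → W) (r : SftSpace A → ℝ)
    (D : ℕ → ℝ) : Prop :=
  ∀ (n : ℕ) (w : ℕ → W), (∀ i, i + 1 < n → A (w i) (w (i + 1)) = true) →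
    ∀ x y : SftSpace A, (∀ i, i < n → x.1 i = w i) →
      (∀ i, i < n → y.1 i = dag (w (n - 1 - i))) →
      Real.exp (birkhoff r n x - birkhoff r n y) ≤ D n

/-- The pair `(ψ, r)` is weakly symmetric. -/
def WeaklySymmetricPair {W G : Type*} [Group G] {A : W → W → Bool} (ψ : W → G)
    (r : SftSpace A → ℝ) : Prop :=
  ∃ dag : W → W, Function.Involutive dag ∧ (∀ v, ψ (dag v) = (ψ v)⁻¹) ∧
    ∃ D : ℕ → ℝ, (∀ n, 0 < D n) ∧
      Tendsto (fun n : ℕ => D n ^ ((n : ℝ)⁻¹)) atTop (nhds 1) ∧ DaggerWeaklySymm dag r D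


/-! ### Two-sided subshifts of finite type -/

/-- The two-sided shift space of the zero-one transition matrix `A`. -/
def Sft2 {W : Type*} (A : W → W → Bool) : Type _ :=
  {x : ℤ → W // ∀ i : ℤ, A (x i) (x (i + 1)) = true}

/-- The shift map on the two-sided shift space. -/
def shift2 {W : Type*} {A : W → W → Bool} (x : Sft2 A) : Sft2 A :=
  ⟨fun i => x.1 (i + 1), fun i => x.2 (i + 1)⟩

/-- Birkhoff sums on the two-sided shift space. -/
def birkhoff2 {W : Type*} {A : W → W → Bool} (f : Sft2 A → ℝ) (n : ℕ) (x : Sft2 A) : ℝ :=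
  ∑ i ∈ Finset.range n, f (shift2^[i] x)

/-- `f` is Lipschitz with constant `C` with respect to the two-sided metric `d_θ`. -/
def Holder2 {W : Type*} {A : W → W → Bool} (θ C : ℝ) (f : Sft2 A → ℝ) : Prop :=
  ∀ (n : ℕ) (x y : Sft2 A), (∀ i : ℤ, |i| < (n : ℤ) → x.1 i = y.1 i) → |f x - f y| ≤ C * θ ^ n

/-- The ordered product `ψⁿ(x) = ψ(x₀)⋯ψ(x_{n-1})` for a two-sided sequence. -/
def psiProd2 {W G : Type*} [Group G] (ψ : W → G) (n : ℕ) (x : ℤ → W) : G :=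
  ((List.range n).map fun i => ψ (x (i : ℤ))).prod

/-- The Gurevič pressure of `f` for the group extension by `ψ_H` (two-sided version). -/
def gurevic2 {W G : Type*} [Group G] {A : W → W → Bool} (f : Sft2 A → ℝ) (ψ : W → G)
    (H : Subgroup G) (hH : H.Normal) : ℝ :=
  limsup (fun n : ℕ =>
    Real.log (∑' x : {x : Sft2 A //
        shift2^[n] x = x ∧ (QuotientGroup.mk (psiProd2 ψ n x.1) : G ⧸ H) = 1},
      Real.exp (birkhoff2 f n x.1)) / n) atTop

/-- The pair `(ψ, f)` is weakly symmetric on the two-sided shift space with respect to the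
involution `dag`: `|fⁿ(x) − fⁿ(x†)| ≤ β n` for every `n`-periodic `x`, where
`(x†)_i = (x_{−i})†`. -/
def WeaklySymm2 {W : Type*} {A : W → W → Bool} (dag : W → W) (f : Sft2 A → ℝ) : Prop :=
  ∃ β : ℕ → ℝ, (∀ n, 0 ≤ β n) ∧ Tendsto (fun n : ℕ => β n / n) atTop (nhds 0) ∧
    ∀ n : ℕ, 1 ≤ n → ∀ x : Sft2 A, shift2^[n] x = x →
      ∀ y : Sft2 A, (∀ i : ℤ, y.1 i = dag (x.1 (-i))) →
        |birkhoff2 f n x - birkhoff2 f n y| ≤ β n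

/-! ### Convolutions and sums over words -/

/-- Convolution of two finitely supported functions on `G`. -/
def conv {G : Type*} [Group G] (μ ν : G → ℝ) : G → ℝ :=
  fun g => ∑' p : {p : G × G // p.1 * p.2 = g}, μ p.1.1 * ν p.1.2

/-- The `k`-fold convolution power `μ^{⋆k}` (with `μ^{⋆0}` the point mass at the identity). -/
def convPow {G : Type*} [Group G] [DecidableEq G] (μ : G → ℝ) : ℕ → G → ℝ
  | 0 => fun g => if g = 1 then 1 else 0
  | k + 1 => conv (convPow μ k) μ

/-- `Σ_{w ∈ Wⁿ_{u,v}} e^{rⁿ(w x)}` where `x ∈ [v]`: the sum of `e^{rⁿ(y)}` over the points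
`y` with `σⁿ y = x` and `y₀ = u`. -/
def preimSum {W : Type*} {A : W → W → Bool} (r : SftSpace A → ℝ) (n : ℕ) (u : W)
    (x : SftSpace A) : ℝ :=
  ∑' y : {y : SftSpace A // shift^[n] y = x ∧ y.1 0 = u}, Real.exp (birkhoff r n y.1)

/-- `Σ_{w ∈ Wⁿ_{u,v}(g)} e^{rⁿ(w x)}` where `x ∈ [v]`. -/
def preimSumG {W G : Type*} [Group G] {A : W → W → Bool} (r : SftSpace A → ℝ) (ψ : W → G)
    (n : ℕ) (u : W) (g : G) (x : SftSpace A) : ℝ :=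
  ∑' y : {y : SftSpace A // shift^[n] y = x ∧ y.1 0 = u ∧ psiProd ψ n y.1 = g},
    Real.exp (birkhoff r n y.1)

/-- `Σ_{w ∈ Wⁿ_{u,v}(g) ∪ Wⁿ_{u,v}(g⁻¹)} e^{rⁿ(w x)}` where `x ∈ [v]`. -/
def preimSumPair {W G : Type*} [Group G] {A : W → W → Bool} (r : SftSpace A → ℝ)
    (ψ : W → G) (n : ℕ) (u : W) (g : G) (x : SftSpace A) : ℝ :=
  ∑' y : {y : SftSpace A // shift^[n] y = x ∧ y.1 0 = u ∧
      (psiProd ψ n y.1 = g ∨ psiProd ψ n y.1 = g⁻¹)},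
    Real.exp (birkhoff r n y.1)

/-! ### Rounding convex weights in an inner product space -/

/-- Moving mass `t` from the coordinate `j` to the coordinate `i`. -/
def moveMass {ι : Type*} [DecidableEq ι] (p : ι → ℝ) (i j : ι) (t : ℝ) : ι → ℝ :=
  fun k => p k + t * ((if k = i then 1 else 0) - (if k = j then 1 else 0))

/-- The quadratic potential which controls the rounding of the weights `p`. -/
def roundingPotential {ι E : Type*} [NormedAddCommGroup E] [InnerProductSpace ℝ E]
    (s : Finset ι) (x : ι → E) (r : ℝ) (p : ι → ℝ) : ℝ :=
  ‖∑ k ∈ s, p k • x k‖ ^ 2 + 2 * r ^ 2 * ∑ k ∈ s, p k * (1 - p k)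

lemma sum_moveMass {ι : Type*} [DecidableEq ι] {s : Finset ι} (p : ι → ℝ) {i j : ι}
    (hi : i ∈ s) (hj : j ∈ s) (t : ℝ) : ∑ k ∈ s, moveMass p i j t k = ∑ k ∈ s, p k := by
  simp [moveMass, Finset.sum_add_distrib, ← Finset.mul_sum, hi, hj]

lemma roundingPotential_moveMass {ι E : Type*} [DecidableEq ι] [NormedAddCommGroup E]
    [InnerProductSpace ℝ E] {s : Finset ι} (x : ι → E) (r : ℝ) (p : ι → ℝ) {i j : ι}
    (hij : i ≠ j) (hi : i ∈ s) (hj : j ∈ s) (t : ℝ) :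
    roundingPotential s x r (moveMass p i j t) = roundingPotential s x r p
      + t * (2 * inner ℝ (∑ k ∈ s, p k • x k) (x i - x j) + 4 * r ^ 2 * (p j - p i))
      + t ^ 2 * (‖x i - x j‖ ^ 2 - 4 * r ^ 2) := by
  have h1 : ∑ k ∈ s, moveMass p i j t k • x k = ∑ k ∈ s, p k • x k + t • (x i - x j) := by
    simp [moveMass, add_smul, Finset.sum_add_distrib, mul_smul, sub_smul, ← Finset.smul_sum,
      hi, hj, ite_smul]
  have h2 : ∑ k ∈ s, moveMass p i j t k * (1 - moveMass p i j t k)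
      = ∑ k ∈ s, p k * (1 - p k) + t * (2 * (p j - p i)) - 2 * t ^ 2 := by
    have : ∀ k, moveMass p i j t k * (1 - moveMass p i j t k) = p k * (1 - p k)
        + ((if k = i then t * (1 - 2 * p k) - t ^ 2 else 0)
        + (if k = j then - t * (1 - 2 * p k) - t ^ 2 else 0)) := by
      intro k
      unfold moveMass
      by_cases hki : k = i <;> by_cases hkj : k = j
      · exact absurd (hki.symm.trans hkj) hij
      · subst hki; simp only [hij, if_true, if_false]; ring
      · subst hkj; simp only [hki, if_true, if_false]; ring
      · simp only [hki, hkj, if_false]; ring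
    simp only [this, Finset.sum_add_distrib, Finset.sum_ite_eq', hi, hj, if_true]
    ring
  unfold roundingPotential
  rw [h1, h2, norm_add_sq_real, inner_smul_right, norm_smul, mul_pow, Real.norm_eq_abs, sq_abs]
  ring

/-- Two fractional weights can be modified, keeping the total weight and not increasing the
potential, so that at least one of them becomes integral. -/
lemma exists_fewer_fractional {ι E : Type*} [DecidableEq ι] [NormedAddCommGroup E]
    [InnerProductSpace ℝ E] {s : Finset ι} (x : ι → E) {r : ℝ} (hx : ∀ k ∈ s, ‖x k‖ ≤ r)
    (p : ι → ℝ) (hp : ∀ k ∈ s, 0 ≤ p k ∧ p k ≤ 1) {i j : ι} (hij : i ≠ j) (hi : i ∈ s)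
    (hj : j ∈ s) (hi' : 0 < p i ∧ p i < 1) (hj' : 0 < p j ∧ p j < 1) :
    ∃ p' : ι → ℝ, (∀ k ∈ s, 0 ≤ p' k ∧ p' k ≤ 1) ∧ ∑ k ∈ s, p' k = ∑ k ∈ s, p k ∧
      roundingPotential s x r p' ≤ roundingPotential s x r p ∧
      (s.filter fun k => 0 < p' k ∧ p' k < 1).card
        < (s.filter fun k => 0 < p k ∧ p k < 1).card := by
  wlog hB : 2 * inner ℝ (∑ k ∈ s, p k • x k) (x i - x j) + 4 * r ^ 2 * (p j - p i) ≤ 0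
    generalizing i j
  · refine this hij.symm hj hi hj' hi' ?_
    rw [← neg_sub (x i), inner_neg_right]
    linarith
  set t := min (1 - p i) (p j) with ht
  have ht0 : 0 < t := lt_min (by linarith) hj'.1
  have hti : t ≤ 1 - p i := min_le_left _ _
  have htj : t ≤ p j := min_le_right _ _
  have hvi : moveMass p i j t i = p i + t := by simp [moveMass, hij]
  have hvj : moveMass p i j t j = p j - t := by simp [moveMass, hij.symm, sub_eq_add_neg]
  have hvk : ∀ k, k ≠ i → k ≠ j → moveMass p i j t k = p k := by
    intro k h1 h2; simp [moveMass, h1, h2]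
  refine ⟨moveMass p i j t, ?_, sum_moveMass p hi hj t, ?_, ?_⟩
  · intro k hk
    by_cases h1 : k = i
    · subst h1; rw [hvi]; constructor <;> linarith
    by_cases h2 : k = j
    · subst h2; rw [hvj]; constructor <;> linarith
    rw [hvk k h1 h2]; exact hp k hk
  · rw [roundingPotential_moveMass x r p hij hi hj]
    have hD : ‖x i - x j‖ ≤ 2 * r := by
      linarith [norm_sub_le (x i) (x j), hx i hi, hx j hj]
    have hD2 : ‖x i - x j‖ ^ 2 ≤ (2 * r) ^ 2 := pow_le_pow_left₀ (norm_nonneg _) hD 2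
    nlinarith [mul_nonneg ht0.le (neg_nonneg.2 hB), mul_nonneg (sq_nonneg t) (sub_nonneg.2 hD2)]
  · apply Finset.card_lt_card
    rw [Finset.ssubset_iff_of_subset]
    · rcases min_choice (1 - p i) (p j) with h | h
      · refine ⟨i, by simp [hi, hi'], ?_⟩
        rw [Finset.mem_filter, hvi, ht, h]
        rintro ⟨-, -, h'⟩; linarith
      · refine ⟨j, by simp [hj, hj'], ?_⟩
        rw [Finset.mem_filter, hvj, ht, h]
        rintro ⟨-, h', -⟩; linarith
    · intro k
      simp only [Finset.mem_filter]
      rintro ⟨hk, h⟩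
      refine ⟨hk, ?_⟩
      by_cases h1 : k = i
      · rw [h1]; exact hi'
      by_cases h2 : k = j
      · rw [h2]; exact hj'
      rwa [hvk k h1 h2] at h

/-- Weights in `[0, 1]` with integral sum `M` can be rounded to the indicator function of a set
with `M` elements without increasing the potential. -/
lemma exists_subset_norm_sq_le {ι E : Type*} [DecidableEq ι] [NormedAddCommGroup E]
    [InnerProductSpace ℝ E] {s : Finset ι} (x : ι → E) {r : ℝ} (hx : ∀ k ∈ s, ‖x k‖ ≤ r)
    (M : ℕ) (p : ι → ℝ) (hp : ∀ k ∈ s, 0 ≤ p k ∧ p k ≤ 1) (hsum : ∑ k ∈ s, p k = M) :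
    ∃ S ⊆ s, S.card = M ∧ ‖∑ k ∈ S, x k‖ ^ 2 ≤ roundingPotential s x r p := by
  induction hN : (s.filter fun k => 0 < p k ∧ p k < 1).card using Nat.strong_induction_on
    generalizing p with
  | _ N ih =>
  by_cases hfrac : ∃ i ∈ s, 0 < p i ∧ p i < 1
  · obtain ⟨i, hi, hi'⟩ := hfrac
    by_cases hother : ∃ j ∈ s, i ≠ j ∧ 0 < p j ∧ p j < 1
    · obtain ⟨j, hj, hij, hj'⟩ := hother
      obtain ⟨p', h1, h2, h3, h4⟩ := exists_fewer_fractional x hx p hp hij hi hj hi' hj'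
      obtain ⟨S, hS, hc, hle⟩ := ih _ (hN ▸ h4) p' h1 (h2.trans hsum) rfl
      exact ⟨S, hS, hc, hle.trans h3⟩
    · exfalso
      push Not at hother
      have hint : ∀ k ∈ s.erase i, p k = if p k = 1 then 1 else 0 := by
        intro k hk
        rw [Finset.mem_erase] at hk
        split_ifs with h
        · exact h
        · by_contra h0
          have hb := hp k hk.2
          exact h (le_antisymm hb.2 (hother k hk.2 hk.1.symm (lt_of_le_of_ne hb.1 (Ne.symm h0))))
      rw [← Finset.add_sum_erase s p hi, Finset.sum_congr rfl hint, Finset.sum_boole] at hsum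
      generalize ((s.erase i).filter fun k => p k = 1).card = c at hsum
      have h1 : (c : ℝ) < M := by linarith [hi'.1]
      have h2 : (M : ℝ) < c + 1 := by linarith [hi'.2]
      norm_cast at h1 h2
      omega
  · push Not at hfrac
    have hint : ∀ k ∈ s, p k = if p k = 1 then 1 else 0 := by
      intro k hk
      split_ifs with h
      · exact h
      · by_contra h0
        have hb := hp k hk
        exact h (le_antisymm hb.2 (hfrac k hk (lt_of_le_of_ne hb.1 (Ne.symm h0))))
    refine ⟨s.filter fun k => p k = 1, Finset.filter_subset _ _, ?_, ?_⟩
    · rw [Finset.sum_congr rfl hint, Finset.sum_boole] at hsum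
      exact_mod_cast hsum
    · have h1 : ∑ k ∈ s, p k • x k = ∑ k ∈ s.filter (fun k => p k = 1), x k := by
        rw [Finset.sum_filter]
        refine Finset.sum_congr rfl fun k hk => ?_
        by_cases h : p k = 1
        · rw [if_pos h, h, one_smul]
        · rw [if_neg h, (hint k hk).trans (if_neg h), zero_smul]
      have h2 : ∑ k ∈ s, p k * (1 - p k) = 0 := by
        refine Finset.sum_eq_zero fun k hk => ?_
        rw [hint k hk]
        split_ifs <;> simp
      simp [roundingPotential, h1, h2]

/-! ### Products of boundedly many elements -/

/-- `g` is a product of at most `k` elements of `S`. -/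
def IsShortProd {G : Type*} [Group G] (S : Finset G) (k : ℕ) (g : G) : Prop :=
  ∃ l : List G, l.length ≤ k ∧ (∀ y ∈ l, y ∈ S) ∧ l.prod = g

lemma isShortProd_one {G : Type*} [Group G] (S : Finset G) : IsShortProd S 0 (1 : G) :=
  ⟨[], by simp⟩

lemma IsShortProd.of_mem {G : Type*} [Group G] {S : Finset G} {g : G} (hg : g ∈ S) :
    IsShortProd S 1 g :=
  ⟨[g], by simpa using hg⟩

lemma IsShortProd.mono {G : Type*} [Group G] {S : Finset G} {j k : ℕ} {g : G}
    (hg : IsShortProd S j g) (hjk : j ≤ k) : IsShortProd S k g := by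
  obtain ⟨l, h1, h2, h3⟩ := hg
  exact ⟨l, h1.trans hjk, h2, h3⟩

lemma IsShortProd.mul {G : Type*} [Group G] {S : Finset G} {j k : ℕ} {g h : G}
    (hg : IsShortProd S j g) (hh : IsShortProd S k h) : IsShortProd S (j + k) (g * h) := by
  obtain ⟨l, h1, h2, h3⟩ := hg
  obtain ⟨m, h4, h5, h6⟩ := hh
  refine ⟨l ++ m, by rw [List.length_append]; omega, ?_, by rw [List.prod_append, h3, h6]⟩
  intro y hy
  rcases List.mem_append.1 hy with h | h
  exacts [h2 y h, h5 y h]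

/-! ### Kazhdan distance -/

section

variable {G E : Type*} [Group G] [NormedAddCommGroup E] [InnerProductSpace ℝ E]
  {ρ : G →* (E ≃ₗᵢ[ℝ] E)} {A B : Finset G} {κ ε : ℝ}

lemma exists_le_norm_sub (hκ : 0 < κ) (hkd : κ ≤ kazhdanDistRep ρ A) {v : E} (hv : ‖v‖ = 1) :
    ∃ a ∈ A, κ ≤ ‖ρ a v - v‖ := by
  have hbdd : BddBelow {c : ℝ | ∃ v : E, ‖v‖ = 1 ∧ c = ⨆ a ∈ A, ‖ρ a v - v‖} := by
    refine ⟨0, ?_⟩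
    rintro c ⟨w, -, rfl⟩
    exact Real.iSup_nonneg fun a => Real.iSup_nonneg fun _ => norm_nonneg _
  have hle : κ ≤ ⨆ a ∈ A, ‖ρ a v - v‖ := hkd.trans (csInf_le hbdd ⟨v, hv, rfl⟩)
  rcases A.eq_empty_or_nonempty with rfl | hA
  · simp at hle
    linarith
  · obtain ⟨a, ha, hmax⟩ := A.exists_max_image (fun a => ‖ρ a v - v‖) hA
    exact ⟨a, ha, hle.trans (Real.iSup_le (fun b => Real.iSup_le (fun hb => hmax b hb)
      (norm_nonneg _)) (norm_nonneg _))⟩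

lemma exists_mul_norm_le_norm_sub [Nontrivial E] (hκ : 0 < κ) (hkd : κ ≤ kazhdanDistRep ρ A)
    (v : E) : ∃ a ∈ A, κ * ‖v‖ ≤ ‖ρ a v - v‖ := by
  by_cases hv : v = 0
  · obtain ⟨w, hw⟩ := exists_norm_eq E zero_le_one
    obtain ⟨a, ha, -⟩ := exists_le_norm_sub hκ hkd hw
    exact ⟨a, ha, by simp [hv]⟩
  · have hv0 : 0 < ‖v‖ := norm_pos_iff.2 hv
    obtain ⟨a, ha, h⟩ := exists_le_norm_sub hκ hkd (v := ‖v‖⁻¹ • v)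
      (by rw [norm_smul, norm_inv, norm_norm, inv_mul_cancel₀ hv0.ne'])
    refine ⟨a, ha, ?_⟩
    rw [map_smul, ← smul_sub, norm_smul, norm_inv, norm_norm, inv_mul_eq_div, le_div_iff₀ hv0] at h
    exact h

lemma kazhdan_le_two [Nontrivial E] (hκ : 0 < κ) (hkd : κ ≤ kazhdanDistRep ρ A) : κ ≤ 2 := by
  obtain ⟨w, hw⟩ := exists_norm_eq E zero_le_one
  obtain ⟨a, -, h⟩ := exists_le_norm_sub hκ hkd hw
  have := norm_sub_le (ρ a w) w
  rw [LinearIsometryEquiv.norm_map, hw] at this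
  linarith

lemma norm_add_sq_le_of_le_norm_sub {x y : E} {c d : ℝ} (hx : ‖x‖ = d) (hy : ‖y‖ = d)
    (hc : 0 ≤ c) (hd : c * d ≤ ‖x - y‖) : ‖x + y‖ ^ 2 ≤ (4 - c ^ 2) * d ^ 2 := by
  have h1 := parallelogram_law_with_norm ℝ x y
  have h0 : 0 ≤ d := hx ▸ norm_nonneg x
  have h2 : (c * d) ^ 2 ≤ ‖x - y‖ ^ 2 := pow_le_pow_left₀ (by positivity) hd 2
  rw [hx, hy] at h1
  nlinarith

/-- Averaging the weights `c` on `T` with their translates by `a`. -/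
lemma sum_averaged_weights {G F : Type*} [Group G] [DecidableEq G] [AddCommGroup F] [Module ℝ F]
    (T : Finset G) (c : G → ℝ) (a : G) (x : G → F) :
    ∑ g ∈ T ∪ T.image (a * ·), ((1 / 2 : ℝ) *
        ((if g ∈ T then c g else 0) + (if a⁻¹ * g ∈ T then c (a⁻¹ * g) else 0))) • x g
      = (1 / 2 : ℝ) • (∑ g ∈ T, c g • x g + ∑ g ∈ T, c g • x (a * g)) := by
  have e1 : ∑ g ∈ T ∪ T.image (a * ·), (if g ∈ T then c g else 0) • x g
      = ∑ g ∈ T, c g • x g := by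
    rw [← Finset.sum_subset Finset.subset_union_left (s₁ := T)]
    · exact Finset.sum_congr rfl fun g hg => by simp [hg]
    · intro g _ hg; simp [hg]
  have e2 : ∑ g ∈ T ∪ T.image (a * ·), (if a⁻¹ * g ∈ T then c (a⁻¹ * g) else 0) • x g
      = ∑ g ∈ T, c g • x (a * g) := by
    rw [← Finset.sum_subset Finset.subset_union_right (s₁ := T.image (a * ·))]
    · rw [Finset.sum_image fun g _ h _ hgh => mul_left_cancel hgh]
      exact Finset.sum_congr rfl fun g hg => by simp [hg]
    · intro g _ hg
      have : a⁻¹ * g ∉ T := fun h => hg (Finset.mem_image.2 ⟨_, h, by simp⟩)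
      simp [this]
  simp only [mul_smul, add_smul]
  rw [← Finset.smul_sum, Finset.sum_add_distrib, e1, e2]

/-- Averaging `k` times along elements of `A` contracts `f` by the factor `(1 - κ² / 16) ^ k`. -/
lemma exists_contracting_weights [DecidableEq G] [Nontrivial E] (hκ : 0 < κ)
    (hkd : κ ≤ kazhdanDistRep ρ A) (f : E) (k : ℕ) :
    ∃ (T : Finset G) (c : G → ℝ), (∀ g, 0 ≤ c g) ∧ ∑ g ∈ T, c g = 1 ∧
      ‖∑ g ∈ T, c g • ρ g f‖ ≤ (1 - κ ^ 2 / 16) ^ k * ‖f‖ ∧ ∀ g ∈ T, IsShortProd A k g := by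
  induction k with
  | zero =>
    exact ⟨{1}, fun _ => 1, fun _ => zero_le_one, by simp, by simp, by
      simpa using isShortProd_one A⟩
  | succ k ih =>
    obtain ⟨T, c, hc, hsum, hnorm, hT⟩ := ih
    set v := ∑ g ∈ T, c g • ρ g f with hv
    obtain ⟨a, ha, hav⟩ := exists_mul_norm_le_norm_sub hκ hkd v
    have hκ2 := kazhdan_le_two hκ hkd
    set d : G → ℝ := fun g => if g ∈ T then c g else 0 with hd
    have hd0 : ∀ g, 0 ≤ d g := fun g => by
      simp only [hd]; split_ifs; exacts [hc g, le_rfl]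
    refine ⟨T ∪ T.image (a * ·), fun g => (1 / 2 : ℝ) * (d g + d (a⁻¹ * g)), ?_, ?_, ?_, ?_⟩
    · intro g
      have := hd0 g
      have := hd0 (a⁻¹ * g)
      positivity
    · have := sum_averaged_weights T c a fun _ => (1 : ℝ)
      simp only [smul_eq_mul, mul_one] at this
      rw [this, hsum]
      norm_num
    · rw [sum_averaged_weights T c a fun g => ρ g f]
      have e : ∑ g ∈ T, c g • ρ (a * g) f = ρ a v := by
        rw [hv, map_sum]
        exact Finset.sum_congr rfl fun g _ => by rw [map_smul, map_mul]; rfl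
      rw [e, ← hv, norm_smul, Real.norm_of_nonneg (by norm_num), pow_succ]
      have h1 := norm_add_sq_le_of_le_norm_sub (LinearIsometryEquiv.norm_map (ρ a) v) rfl hκ.le hav
      have h2 : ‖v + ρ a v‖ ≤ 2 * (1 - κ ^ 2 / 16) * ‖v‖ := by
        refine le_of_sq_le_sq ?_ ?_
        · rw [add_comm]
          nlinarith [mul_nonneg (sq_nonneg κ) (sq_nonneg ‖v‖),
            mul_nonneg (sq_nonneg (κ ^ 2)) (sq_nonneg ‖v‖)]
        · have : 0 ≤ 1 - κ ^ 2 / 16 := by nlinarith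
          positivity
      have h3 : (0 : ℝ) ≤ 1 - κ ^ 2 / 16 := by nlinarith
      nlinarith [mul_le_mul_of_nonneg_left hnorm h3]
    · intro g hg
      rcases Finset.mem_union.1 hg with h | h
      · exact (hT g h).mono (Nat.le_succ k)
      · obtain ⟨t, ht, rfl⟩ := Finset.mem_image.1 h
        exact ((IsShortProd.of_mem ha).mul (hT t ht)).mono (by omega)

end

section

variable {G E : Type*} [Group G] [DecidableEq G] [NormedAddCommGroup E] [InnerProductSpace ℝ E]
  {ρ : G →* (E ≃ₗᵢ[ℝ] E)} {A B : Finset G} {κ ε : ℝ}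

lemma exists_large_set (hε1 : ε < 1)
    (hB : ∀ E' : Finset G, E'.Nonempty →
      ∃ b ∈ B, ((E' ∩ E'.image (· * b)).card : ℝ) ≤ ε * E'.card) (k : ℕ) :
    ∃ U : Finset G, (2 * (1 - ε)) ^ k ≤ (U.card : ℝ) ∧ ∀ g ∈ U, IsShortProd B k g := by
  induction k with
  | zero => exact ⟨{1}, by simp, by simpa using isShortProd_one B⟩
  | succ k ih =>
    obtain ⟨U, hU, hw⟩ := ih
    have hpos : (0 : ℝ) < U.card := lt_of_lt_of_le (pow_pos (by linarith) k) hU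
    obtain ⟨b, hb, hle⟩ := hB U (Finset.card_pos.1 (by exact_mod_cast hpos))
    refine ⟨U ∪ U.image (· * b), ?_, ?_⟩
    · have h1 := Finset.card_union_add_card_inter U (U.image (· * b))
      rw [Finset.card_image_of_injective U (mul_left_injective b)] at h1
      have h2 : ((U ∪ U.image (· * b)).card : ℝ) + (U ∩ U.image (· * b)).card
          = U.card + U.card := by exact_mod_cast h1
      rw [pow_succ]
      nlinarith [(Nat.cast_nonneg (U ∩ U.image (· * b)).card : (0 : ℝ) ≤ _)]
    · intro g hg
      rcases Finset.mem_union.1 hg with h | h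
      · exact (hw g h).mono (Nat.le_succ k)
      · obtain ⟨t, ht, rfl⟩ := Finset.mem_image.1 h
        exact (hw t ht).mul (.of_mem hb)

lemma exists_disjoint_translate
    (hB : ∀ E' : Finset G, E'.Nonempty →
      ∃ b ∈ B, ((E' ∩ E'.image (· * b)).card : ℝ) ≤ ε * E'.card) {F : Finset G}
    (hF : F.Nonempty) (hcard : ε * F.card < 1) : ∃ b ∈ B, ∀ g ∈ F, b * g ∉ F := by
  obtain ⟨b, hb, hle⟩ := hB (F.image (·⁻¹)) (hF.image _)
  rw [Finset.card_image_of_injective F inv_injective] at hle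
  refine ⟨b, hb, fun g hg hbg => ?_⟩
  have hpos : 0 < (F.image (·⁻¹) ∩ (F.image (·⁻¹)).image (· * b)).card := by
    refine Finset.card_pos.2 ⟨g⁻¹, Finset.mem_inter.2 ⟨Finset.mem_image_of_mem _ hg, ?_⟩⟩
    exact Finset.mem_image.2 ⟨(b * g)⁻¹, Finset.mem_image_of_mem _ hbg, by simp⟩
  have : (1 : ℝ) ≤ (F.image (·⁻¹) ∩ (F.image (·⁻¹)).image (· * b)).card := by exact_mod_cast hpos
  linarith

lemma sum_image_mul_left (s : Finset G) (b : G) (f : E) :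
    ∑ g ∈ s.image (b * ·), ρ g f = ρ b (∑ g ∈ s, ρ g f) := by
  rw [Finset.sum_image fun g _ h _ hgh => mul_left_cancel hgh, map_sum]
  exact Finset.sum_congr rfl fun g _ => by rw [map_mul]; rfl

/-- As long as the sets are so small that translates can be chosen disjoint, the size doubles in
each step. -/
lemma exists_set_of_small [Nontrivial E] (hκ : 0 < κ) (hkd : κ ≤ kazhdanDistRep ρ A)
    (hε0 : 0 < ε) (hB1 : (1 : G) ∈ B)
    (hB : ∀ E' : Finset G, E'.Nonempty →
      ∃ b ∈ B, ((E' ∩ E'.image (· * b)).card : ℝ) ≤ ε * E'.card)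
    (f : E) (n : ℕ) (hn : 2 ^ n * ε < 1) :
    ∃ S : Finset G, ‖∑ g ∈ S, ρ g f‖ ≤ (2 * Real.sqrt (1 - κ ^ 2 / 16)) ^ n * ‖f‖ ∧
      S.card = 2 ^ n ∧ ∀ g ∈ S, IsShortProd (A ∪ B) n g := by
  have hκ2 := kazhdan_le_two hκ hkd
  have hq : 0 ≤ 1 - κ ^ 2 / 16 := by nlinarith
  induction n with
  | zero => exact ⟨{1}, by simp, by simp, by simpa using isShortProd_one _⟩
  | succ n ih =>
    rw [pow_succ] at hn
    obtain ⟨S, hS, hc, hw⟩ := ih (by nlinarith [pow_pos (zero_lt_two (α := ℝ)) n])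
    have hSne : S.Nonempty := Finset.card_pos.1 (by rw [hc]; positivity)
    set v := ∑ g ∈ S, ρ g f with hv
    obtain ⟨a, ha, hav⟩ := exists_mul_norm_le_norm_sub hκ hkd v
    obtain ⟨b, hb, hdisj⟩ := exists_disjoint_translate (F := S ∪ S.image (a * ·)) hB
      (hSne.mono Finset.subset_union_left) (by
        have h1 := Finset.card_union_le S (S.image (a * ·))
        rw [Finset.card_image_of_injective S (mul_right_injective a), hc] at h1
        have h2 : ((S ∪ S.image (a * ·)).card : ℝ) ≤ 2 ^ n + 2 ^ n := by exact_mod_cast h1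
        nlinarith)
    have hstep : ∃ s ∈ A ∪ B, Disjoint (S.image (s * ·)) (S.image (b * ·)) ∧
        κ / 2 * ‖v‖ ≤ ‖ρ s v - ρ b v‖ := by
      by_cases hbv : κ / 2 * ‖v‖ ≤ ‖v - ρ b v‖
      · refine ⟨1, Finset.mem_union_right _ hB1, ?_, by rw [map_one]; exact hbv⟩
        rw [Finset.disjoint_left]
        intro x hx hx'
        obtain ⟨y, hy, rfl⟩ := Finset.mem_image.1 hx'
        refine hdisj y (Finset.mem_union_left _ hy) (Finset.mem_union_left _ ?_)
        simpa using hx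
      · refine ⟨a, Finset.mem_union_left _ ha, ?_, ?_⟩
        · rw [Finset.disjoint_left]
          intro x hx hx'
          obtain ⟨y, hy, rfl⟩ := Finset.mem_image.1 hx'
          exact hdisj y (Finset.mem_union_left _ hy) (Finset.mem_union_right _ hx)
        · have := norm_sub_le_norm_sub_add_norm_sub (ρ a v) (ρ b v) v
          rw [norm_sub_rev (ρ b v) v] at this
          linarith
    obtain ⟨s, hs, hd, hsv⟩ := hstep
    refine ⟨S.image (s * ·) ∪ S.image (b * ·), ?_, ?_, ?_⟩
    · rw [Finset.sum_union hd, sum_image_mul_left, sum_image_mul_left, ← hv, pow_succ]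
      have h1 := norm_add_sq_le_of_le_norm_sub (LinearIsometryEquiv.norm_map (ρ s) v)
        (LinearIsometryEquiv.norm_map (ρ b) v) (by positivity) hsv
      have h2 : ‖ρ s v + ρ b v‖ ≤ 2 * Real.sqrt (1 - κ ^ 2 / 16) * ‖v‖ := by
        refine le_of_sq_le_sq ?_ (by positivity)
        rw [mul_pow, mul_pow, Real.sq_sqrt hq]
        linarith
      calc _ ≤ _ := h2
        _ ≤ 2 * Real.sqrt (1 - κ ^ 2 / 16)
            * ((2 * Real.sqrt (1 - κ ^ 2 / 16)) ^ n * ‖f‖) := by gcongr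
        _ = _ := by ring
    · rw [Finset.card_union_of_disjoint hd,
        Finset.card_image_of_injective S (mul_right_injective s),
        Finset.card_image_of_injective S (mul_right_injective b), hc]
      ring
    · intro g hg
      rcases Finset.mem_union.1 hg with h | h
      all_goals obtain ⟨t, ht, rfl⟩ := Finset.mem_image.1 h
      · exact ((IsShortProd.of_mem hs).mul (hw t ht)).mono (by omega)
      · exact ((IsShortProd.of_mem (Finset.mem_union_right _ hb)).mul (hw t ht)).mono (by omega)

/-- Spreading the weights `c` over the translates of `T` by a large set `U`, and rounding. -/
lemma exists_set_of_weights {U T : Finset G} {c : G → ℝ} (hc : ∀ g, 0 ≤ c g)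
    (hsum : ∑ g ∈ T, c g = 1) (f : E) {M : ℕ} (hM0 : 0 < M) (hM : M ≤ U.card) :
    ∃ S : Finset G, (∀ g ∈ S, ∃ u ∈ U, ∃ t ∈ T, u * t = g) ∧ S.card = M ∧
      ‖∑ g ∈ S, ρ g f‖ ^ 2 ≤ M ^ 2 * ‖∑ g ∈ T, c g • ρ g f‖ ^ 2 + 2 * M * ‖f‖ ^ 2 := by
  set v := ∑ g ∈ T, c g • ρ g f with hv
  have hU0 : (0 : ℝ) < U.card := by exact_mod_cast hM0.trans_le hM
  have hMU : (M : ℝ) / U.card ≤ 1 := (div_le_one hU0).2 (by exact_mod_cast hM)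
  set P := (U ×ˢ T).image fun z => z.1 * z.2 with hP
  have hmaps : ∀ z ∈ U ×ˢ T, z.1 * z.2 ∈ P := fun z hz => Finset.mem_image_of_mem _ hz
  set p : G → ℝ := fun g => ∑ z ∈ (U ×ˢ T).filter (fun z => z.1 * z.2 = g),
    (M : ℝ) / U.card * c z.2 with hp
  have hp0 : ∀ g, 0 ≤ p g := fun g => Finset.sum_nonneg fun z _ =>
    mul_nonneg (by positivity) (hc _)
  have hp1 : ∀ g, p g ≤ 1 := by
    intro g
    have hinj : Set.InjOn Prod.snd
        (((U ×ˢ T).filter fun z => z.1 * z.2 = g : Finset (G × G)) : Set (G × G)) := by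
      rintro ⟨u, t⟩ h ⟨u', t'⟩ h' (rfl : t = t')
      simp only [Finset.coe_filter, Set.mem_ofPred_eq] at h h'
      rw [mul_right_cancel (h.2.trans h'.2.symm)]
    have hle : ∑ z ∈ (U ×ˢ T).filter (fun z => z.1 * z.2 = g), c z.2 ≤ 1 := by
      rw [← Finset.sum_image (f := c) hinj, ← hsum]
      refine Finset.sum_le_sum_of_subset_of_nonneg ?_ fun g _ _ => hc g
      intro t ht
      obtain ⟨z, hz, rfl⟩ := Finset.mem_image.1 ht
      exact (Finset.mem_product.1 (Finset.mem_filter.1 hz).1).2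
    simp only [hp]
    rw [← Finset.mul_sum]
    exact mul_le_one₀ hMU (Finset.sum_nonneg fun z _ => hc _) hle
  have hpsum : ∑ g ∈ P, p g = M := by
    simp only [hp]
    rw [Finset.sum_fiberwise_of_maps_to hmaps, Finset.sum_product]
    simp only [← Finset.mul_sum, hsum, Finset.sum_const, nsmul_eq_mul, mul_one]
    field_simp
  have hpvec : ∑ g ∈ P, p g • ρ g f = ((M : ℝ) / U.card) • ∑ u ∈ U, ρ u v := by
    have h1 : ∀ g ∈ P, p g • ρ g f = ∑ z ∈ (U ×ˢ T).filter (fun z => z.1 * z.2 = g),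
        ((M : ℝ) / U.card * c z.2) • ρ (z.1 * z.2) f := by
      intro g _
      simp only [hp, Finset.sum_smul]
      exact Finset.sum_congr rfl fun z hz => by rw [(Finset.mem_filter.1 hz).2]
    rw [Finset.sum_congr rfl h1, Finset.sum_fiberwise_of_maps_to hmaps, Finset.sum_product,
      Finset.smul_sum]
    refine Finset.sum_congr rfl fun u _ => ?_
    rw [hv, map_sum, Finset.smul_sum]
    refine Finset.sum_congr rfl fun t _ => ?_
    rw [map_smul, map_mul, mul_smul]
    rfl
  obtain ⟨S, hSP, hcard, hle⟩ := exists_subset_norm_sq_le (s := P) (fun g => ρ g f)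
    (r := ‖f‖) (fun g _ => (LinearIsometryEquiv.norm_map (ρ g) f).le) M p
    (fun g _ => ⟨hp0 g, hp1 g⟩) hpsum
  refine ⟨S, ?_, hcard, hle.trans ?_⟩
  · intro g hg
    obtain ⟨z, hz, rfl⟩ := Finset.mem_image.1 (hSP hg)
    exact ⟨z.1, (Finset.mem_product.1 hz).1, z.2, (Finset.mem_product.1 hz).2, rfl⟩
  · unfold roundingPotential
    have h1 : ‖∑ g ∈ P, p g • ρ g f‖ ≤ M * ‖v‖ := by
      rw [hpvec, norm_smul, Real.norm_of_nonneg (by positivity)]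
      have h2 : ‖∑ u ∈ U, ρ u v‖ ≤ U.card * ‖v‖ := by
        refine (norm_sum_le _ _).trans ?_
        simp
      calc _ ≤ (M : ℝ) / U.card * (U.card * ‖v‖) := by gcongr
        _ = _ := by field_simp
    have h2 : ∑ g ∈ P, p g * (1 - p g) ≤ M := by
      rw [← hpsum]
      exact Finset.sum_le_sum fun g _ => by nlinarith [hp0 g]
    have h3 := pow_le_pow_left₀ (norm_nonneg _) h1 2
    nlinarith [mul_le_mul_of_nonneg_left h2 (sq_nonneg ‖f‖)]

end

lemma rounding_numeric {n : ℕ} (hn : 1 ≤ n) {y q m : ℝ} (hy : 3 / 4 ≤ y) (hy1 : y ≤ 1)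
    (hq : q = y ^ n) (hm0 : 0 ≤ m) (hm : m ≤ 2 ^ n - 1) :
    m ^ 2 * q ^ 2 + 2 * m ≤ (2 ^ n) ^ 2 * q := by
  have hq1 : q ≤ 1 := hq ▸ pow_le_one₀ (by linarith) hy1
  have hq0 : (3 / 4) ^ n ≤ q := hq ▸ pow_le_pow_left₀ (by norm_num) hy n
  have hqpos : 0 < q := lt_of_lt_of_le (by positivity) hq0
  have hmono : m ^ 2 * q ^ 2 + 2 * m ≤ (2 ^ n - 1) ^ 2 * q ^ 2 + 2 * (2 ^ n - 1) := by
    gcongr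
  refine hmono.trans ?_
  obtain rfl | rfl | hn3 : n = 1 ∨ n = 2 ∨ 3 ≤ n := by omega
  · norm_num at hq0 ⊢; nlinarith
  · norm_num at hq0 ⊢; nlinarith
  · have hx : (8 : ℝ) ≤ 2 ^ n := by
      calc (8 : ℝ) = 2 ^ 3 := by norm_num
        _ ≤ 2 ^ n := pow_le_pow_right₀ (by norm_num) hn3
    have h32 : (27 / 8 : ℝ) ≤ (3 / 2) ^ n := by
      calc (27 / 8 : ℝ) = (3 / 2) ^ 3 := by norm_num
        _ ≤ (3 / 2) ^ n := pow_le_pow_right₀ (by norm_num) hn3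
    have hxq : 27 / 8 ≤ 2 ^ n * q := by
      calc (27 / 8 : ℝ) ≤ (3 / 2) ^ n := h32
        _ = 2 ^ n * (3 / 4) ^ n := by rw [← mul_pow]; norm_num
        _ ≤ _ := by gcongr
    generalize (2 : ℝ) ^ n = x at *
    have h1 : (7 / 8 * x) ^ 2 ≤ (x - 1) ^ 2 := pow_le_pow_left₀ (by linarith) (by linarith) 2
    have h2 : 2 * x ≤ (x - 1) ^ 2 * q := by nlinarith
    nlinarith [mul_nonneg (sub_nonneg.2 hq1) (sub_nonneg.2 h2)]

/-- The inductive construction of the sets `Eₙ`: under a Kazhdan distance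
bound `κ_A(ρ, 𝟙) ≥ κ` and a Følner-type property of the finite set `B ∋ 1`, for every vector
`f` and every `n ≥ 1` there is a finite `Eₙ ⊆ G` with
`‖Σ_{g∈Eₙ} ρ(g)f‖ ≤ (2κ₁)ⁿ ‖f‖`, `#Eₙ ≥ (2(1−ε))ⁿ`, and every element of `Eₙ` a product of
at most `2n` elements of `A ∪ B`, where `κ₁ = √(1 − κ²/16)`. -/
theorem statement7 {G E : Type*} [Group G] [Countable G] [DecidableEq G]
    [NormedAddCommGroup E] [InnerProductSpace ℝ E] [CompleteSpace E]
    (ρ : G →* (E ≃ₗᵢ[ℝ] E)) (A : Finset G)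
    (κ : ℝ) (hκ : 0 < κ) (hkd : κ ≤ kazhdanDistRep ρ A)
    (ε : ℝ) (hε0 : 0 < ε) (hε1 : ε < 1)
    (B : Finset G) (hB1 : (1 : G) ∈ B)
    (hB : ∀ E' : Finset G, E'.Nonempty →
      ∃ b ∈ B, ((E' ∩ E'.image (· * b)).card : ℝ) ≤ ε * E'.card)
    (f : E) (n : ℕ) (hn : 1 ≤ n) :
    ∃ En : Finset G,
      ‖∑ g ∈ En, ρ g f‖ ≤ (2 * Real.sqrt (1 - κ ^ 2 / 16)) ^ n * ‖f‖ ∧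
      (2 * (1 - ε)) ^ n ≤ (En.card : ℝ) ∧
      ∀ g ∈ En, ∃ l : List G, l.length ≤ 2 * n ∧ (∀ y ∈ l, y ∈ A ∪ B) ∧ l.prod = g := by
  rcases eq_or_ne f 0 with rfl | hf
  · obtain ⟨U, hU, hw⟩ := exists_large_set hε1 hB n
    refine ⟨U, by simp, hU, fun g hg => ?_⟩
    obtain ⟨l, h1, h2, h3⟩ := hw g hg
    exact ⟨l, by omega, fun y hy => Finset.mem_union_right _ (h2 y hy), h3⟩
  have : Nontrivial E := ⟨f, 0, hf⟩
  have hκ2 := kazhdan_le_two hκ hkd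
  have hpow0 : (0 : ℝ) < (2 * (1 - ε)) ^ n := pow_pos (by linarith) n
  by_cases hsmall : 2 ^ n * ε < 1
  · obtain ⟨S, h1, h2, h3⟩ := exists_set_of_small hκ hkd hε0 hB1 hB f n hsmall
    refine ⟨S, h1, ?_, fun g hg => (h3 g hg).mono (by omega)⟩
    rw [h2]
    push_cast
    exact pow_le_pow_left₀ (by linarith) (by linarith) n
  · obtain ⟨U, hU, hUw⟩ := exists_large_set hε1 hB n
    obtain ⟨T, c, hc, hsum, hnorm, hTw⟩ := exists_contracting_weights hκ hkd f n
    set M := ⌈(2 * (1 - ε)) ^ n⌉₊ with hM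
    obtain ⟨S, hS, hcard, hle⟩ := exists_set_of_weights (ρ := ρ) (U := U) hc hsum f
      (Nat.ceil_pos.2 hpow0) (Nat.ceil_le.2 hU)
    refine ⟨S, ?_, by rw [hcard]; exact Nat.le_ceil _, fun g hg => ?_⟩
    · have hMle : (M : ℝ) ≤ 2 ^ n - 1 := by
        have h1 : (2 * (1 - ε)) ^ n ≤ 2 ^ n - 1 := by
          have h2 : (1 - ε) ^ n ≤ 1 - ε := pow_le_of_le_one (by linarith) (by linarith) (by omega)
          rw [mul_pow]
          nlinarith [pow_pos (zero_lt_two (α := ℝ)) n]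
        have h2 : M ≤ 2 ^ n - 1 := by
          refine Nat.ceil_le.2 (h1.trans_eq ?_)
          rw [Nat.cast_sub Nat.one_le_two_pow]
          push_cast
          ring
        have h3 : (M : ℝ) ≤ ((2 ^ n - 1 : ℕ) : ℝ) := by exact_mod_cast h2
        rwa [Nat.cast_sub Nat.one_le_two_pow, Nat.cast_pow, Nat.cast_ofNat, Nat.cast_one] at h3
      set y := 1 - κ ^ 2 / 16 with hy
      have hy0 : 3 / 4 ≤ y := by nlinarith
      have hnum := rounding_numeric hn hy0 (by nlinarith) rfl (Nat.cast_nonneg M) hMle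
      refine le_of_sq_le_sq (hle.trans ?_) (by positivity)
      have h1 := pow_le_pow_left₀ (norm_nonneg _) hnorm 2
      calc (M : ℝ) ^ 2 * ‖∑ g ∈ T, c g • ρ g f‖ ^ 2 + 2 * M * ‖f‖ ^ 2
          ≤ M ^ 2 * (y ^ n * ‖f‖) ^ 2 + 2 * M * ‖f‖ ^ 2 := by gcongr
        _ = (M ^ 2 * (y ^ n) ^ 2 + 2 * M) * ‖f‖ ^ 2 := by ring
        _ ≤ (2 ^ n) ^ 2 * y ^ n * ‖f‖ ^ 2 := by gcongr
        _ = ((2 * Real.sqrt y) ^ n * ‖f‖) ^ 2 := by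
          rw [mul_pow ((2 * Real.sqrt y) ^ n), pow_right_comm (2 * Real.sqrt y), mul_pow 2,
            Real.sq_sqrt (by linarith), mul_pow, pow_right_comm (2 : ℝ) 2]
    · obtain ⟨u, hu, t, ht, rfl⟩ := hS g hg
      obtain ⟨l, h1, h2, h3⟩ := (hUw u hu)
      obtain ⟨l', h1', h2', h3'⟩ := (hTw t ht)
      refine ⟨l ++ l', by rw [List.length_append]; omega, fun y hy => ?_, by
        rw [List.prod_append, h3, h3']⟩
      rcases List.mem_append.1 hy with h | h
      exacts [Finset.mem_union_right _ (h2 y h), Finset.mem_union_left _ (h2' y h)]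

end CriticalExponents
end
end

section
/- Let σ : Σ⁺ → Σ⁺ be a topologically mixing one-sided subshift of finite type over a finite alphabet W with transition matrix A, let r : Σ⁺ → ℝ be Hölder continuous, and let † be an involution of W such that A(i,j) = 1 implies A(j†, i†) = 1. Then † is weakly symmetric with respect to r if and only if there exist β(n) ≥ 0 with β(n)/n → 0 such that for every n ≥ 1 and every x ∈ Σ⁺ with σⁿx = x one has |rⁿ(x) − rⁿ(x†)| ≤ β(n), where x† is the n-periodic point of Σ⁺ determined by (x†)_i = (x_{(n−i) mod n})† for 0 ≤ i ≤ n−1. -/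
open Filter

noncomputable section

namespace CriticalExponents

section PeriodicPoints

variable {W : Type*} {A : W → W → Bool}

theorem shift_iterate_apply (x : SftSpace A) (n i : ℕ) :
    (shift^[n] x).1 i = x.1 (i + n) := by
  induction n generalizing x with
  | zero => rfl
  | succ n ih =>
    rw [Function.iterate_succ_apply, ih]
    change x.1 (i + n + 1) = _
    rw [add_assoc]

theorem birkhoff_succ (r : SftSpace A → ℝ) (n : ℕ) (x : SftSpace A) :
    birkhoff r (n + 1) x = birkhoff r n (shift x) + r x :=
  Finset.sum_range_succ' _ _

theorem birkhoff_add (r : SftSpace A → ℝ) (n k : ℕ) (x : SftSpace A) :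
    birkhoff r (n + k) x = birkhoff r n x + birkhoff r k (shift^[n] x) := by
  simp only [birkhoff, Finset.sum_range_add, ← Function.iterate_add_apply, add_comm]

theorem birkhoff_shift_iterate_of_periodic (r : SftSpace A → ℝ) {n : ℕ} {x : SftSpace A}
    (hx : shift^[n] x = x) (k : ℕ) : birkhoff r n (shift^[k] x) = birkhoff r n x := by
  have h := birkhoff_add r n k x
  rw [hx, add_comm n k, birkhoff_add] at h
  linarith

/-- Bounded distortion of Birkhoff sums on cylinders. -/
theorem HolderWith.abs_birkhoff_sub_le {θ C : ℝ} {r : SftSpace A → ℝ} (hr : HolderWith θ C r)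
    (hθ0 : 0 < θ) (hθ1 : θ < 1) {n : ℕ} {x y : SftSpace A} (h : ∀ i, i < n → x.1 i = y.1 i) :
    |birkhoff r n x - birkhoff r n y| ≤ C / (1 - θ) := by
  have hC : 0 ≤ C := by simpa using hr 0 x x (by simp)
  have hK : 0 ≤ C / (1 - θ) := div_nonneg hC (by linarith)
  have hKC : C / (1 - θ) * (1 - θ) = C := div_mul_cancel₀ _ (by linarith)
  set K := C / (1 - θ)
  suffices |birkhoff r n x - birkhoff r n y| ≤ K * (1 - θ ^ (n + 1)) by
    nlinarith [mul_nonneg hK (pow_pos hθ0 (n + 1)).le]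
  induction n generalizing x y with
  | zero => simpa [birkhoff, hKC] using hC
  | succ n ih =>
    have hshift := ih (x := shift x) (y := shift y) fun i hi => h (i + 1) (by lia)
    have hhead := hr (n + 1) x y h
    rw [birkhoff_succ, birkhoff_succ]
    calc |birkhoff r n (shift x) + r x - (birkhoff r n (shift y) + r y)|
        = |(birkhoff r n (shift x) - birkhoff r n (shift y)) + (r x - r y)| := by ring_nf
      _ ≤ K * (1 - θ ^ (n + 1)) + C * θ ^ (n + 1) :=
          (abs_add_le _ _).trans (add_le_add hshift hhead)
      _ = K * (1 - θ ^ (n + 1 + 1)) := by rw [← hKC]; ring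

theorem HolderWith.abs_birkhoff_sub_le_mul {θ C : ℝ} {r : SftSpace A → ℝ}
    (hr : HolderWith θ C r) (n : ℕ) (x y : SftSpace A) :
    |birkhoff r n x - birkhoff r n y| ≤ n * C := by
  rw [birkhoff, birkhoff, ← Finset.sum_sub_distrib]
  refine (Finset.abs_sum_le_sum_abs _ _).trans ((Finset.sum_le_card_nsmul _ _ C ?_).trans ?_)
  · intro i _
    simpa using hr 0 (shift^[i] x) (shift^[i] y) (by simp)
  · simp

/-- A closed admissible path `v 0, …, v m = v 0` determines an `m`-periodic point. -/
theorem exists_periodic_of_closed_path {m : ℕ} (hm : 0 < m) {v : ℕ → W}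
    (hv : ∀ t, t < m → A (v t) (v (t + 1)) = true) (hclosed : v m = v 0) :
    ∃ p : SftSpace A, shift^[m] p = p ∧ ∀ i, p.1 i = v (i % m) := by
  refine ⟨⟨fun i => v (i % m), fun i => ?_⟩, ?_, fun _ => rfl⟩
  · have hlt := Nat.mod_lt i hm
    have hstep : v ((i + 1) % m) = v (i % m + 1) := by
      rw [Nat.add_mod_eq_ite]
      rcases Nat.lt_or_ge 1 m with h1 | h1
      · rw [Nat.mod_eq_of_lt h1]
        split_ifs with h
        · have : i % m + 1 = m := by lia
          rw [this, hclosed, Nat.sub_self]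
        · rfl
      · obtain rfl : m = 1 := by lia
        simp [Nat.mod_one, hclosed]
    change A (v (i % m)) (v ((i + 1) % m)) = true
    rw [hstep]
    exact hv _ hlt
  · apply Subtype.ext
    funext i
    exact (shift_iterate_apply _ m i).trans (congrArg v (Nat.add_mod_right i m))

/-- In an aperiodic subshift every admissible word can be continued to a closed path, with a
continuation of fixed length. -/
theorem exists_closed_path_extending {N k : ℕ}
    (hpath : ∀ i j : W, ∃ u : ℕ → W,
      u 0 = i ∧ u N = j ∧ ∀ t, t < N → A (u t) (u (t + 1)) = true)
    {w : ℕ → W} (hw : ∀ i, i < k → A (w i) (w (i + 1)) = true) :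
    ∃ v : ℕ → W, (∀ i, i ≤ k → v i = w i) ∧ v (k + N) = v 0 ∧
      ∀ t, t < k + N → A (v t) (v (t + 1)) = true := by
  obtain ⟨u, hu0, huN, hu⟩ := hpath (w k) (w 0)
  have hv_le : ∀ i, i ≤ k → (if i ≤ k then w i else u (i - k)) = w i :=
    fun i hi => if_pos hi
  have hv_ge : ∀ i, (if k + i ≤ k then w (k + i) else u (k + i - k)) = u i := by
    intro i
    rcases i.eq_zero_or_pos with rfl | hi
    · simp [hu0]
    · rw [if_neg (by lia), Nat.add_sub_cancel_left]
  refine ⟨fun i => if i ≤ k then w i else u (i - k), hv_le, ?_, fun t ht => ?_⟩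
  · exact (hv_ge N).trans (huN.trans (hv_le 0 k.zero_le).symm)
  · dsimp only
    rcases Nat.lt_or_ge t k with h | h
    · rw [hv_le t h.le, hv_le (t + 1) h]
      exact hw t h
    · obtain ⟨s, rfl⟩ := Nat.exists_eq_add_of_le h
      rw [hv_ge s, add_assoc, hv_ge (s + 1)]
      exact hu s (by lia)

end PeriodicPoints

section WeakSymmetry

variable {W : Type*} {A : W → W → Bool} {r : SftSpace A → ℝ} {dag : W → W}

theorem DaggerWeaklySymm.abs_birkhoff_sub_le {D : ℕ → ℝ} (hD : DaggerWeaklySymm dag r D)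
    (hinv : Function.Involutive dag) {n : ℕ} (hn : 1 ≤ n) {x y : SftSpace A}
    (hy : shift^[n] y = y) (hxy : ∀ i, i < n → y.1 i = dag (x.1 ((n - i) % n))) :
    |birkhoff r n x - birkhoff r n y| ≤ Real.log (D n) := by
  have hcoord : ∀ i, i < n → (shift y).1 i = dag (x.1 (n - 1 - i)) := by
    intro i hi
    change y.1 (i + 1) = _
    rcases Nat.lt_or_ge (i + 1) n with h | h
    · rw [hxy _ h, Nat.mod_eq_of_lt (by lia), Nat.sub_sub, Nat.add_comm 1 i]
    · obtain rfl : n = i + 1 := by lia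
      have hper : y.1 (0 + (i + 1)) = y.1 0 := by rw [← shift_iterate_apply, hy]
      rw [Nat.zero_add] at hper
      rw [hper, hxy 0 hn]
      simp
  have hsum : birkhoff r n (shift y) = birkhoff r n y :=
    birkhoff_shift_iterate_of_periodic r hy 1
  have hle := hD n x.1 (fun i _ => x.2 i) x (shift y) (fun _ _ => rfl) hcoord
  have hge := hD n (shift y).1 (fun i _ => (shift y).2 i) (shift y) x (fun _ _ => rfl) (by
    intro i hi
    rw [hcoord _ (by lia), hinv, show n - 1 - (n - 1 - i) = i by lia])
  rw [hsum] at hle hge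
  have hpos : 0 < D n := (Real.exp_pos _).trans_le hle
  rw [← Real.le_log_iff_exp_le hpos] at hle hge
  exact abs_sub_le_iff.2 ⟨hle, hge⟩

theorem tendsto_log_div_of_tendsto_rpow_inv {D : ℕ → ℝ} (hpos : ∀ n, 0 < D n)
    (hD : Tendsto (fun n : ℕ => D n ^ ((n : ℝ)⁻¹)) atTop (nhds 1)) :
    Tendsto (fun n : ℕ => Real.log (D n) / n) atTop (nhds 0) := by
  have h := hD.log one_ne_zero
  rw [Real.log_one] at h
  refine h.congr fun n => ?_
  rw [Real.log_rpow (hpos n), div_eq_inv_mul]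

theorem tendsto_exp_rpow_inv {γ : ℕ → ℝ}
    (hγ : Tendsto (fun n : ℕ => γ n / n) atTop (nhds 0)) :
    Tendsto (fun n : ℕ => Real.exp (γ n) ^ ((n : ℝ)⁻¹)) atTop (nhds 1) := by
  have h := (Real.continuous_exp.tendsto 0).comp hγ
  rw [Real.exp_zero] at h
  refine h.congr fun n => ?_
  rw [← Real.exp_mul, Function.comp_apply, div_eq_mul_inv]

theorem tendsto_shift_add_const_div {β : ℕ → ℝ}
    (hβ : Tendsto (fun n : ℕ => β n / n) atTop (nhds 0)) (k : ℕ) (c : ℝ) :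
    Tendsto (fun n : ℕ => (β (n + k) + c) / n) atTop (nhds 0) := by
  have hinv := tendsto_inv_atTop_nhds_zero_nat (𝕜 := ℝ)
  have h := ((hβ.comp (tendsto_add_atTop_nat k)).mul
    ((hinv.const_mul (k : ℝ)).const_add 1)).add (hinv.const_mul c)
  simp only [mul_zero, add_zero, zero_mul] at h
  refine h.congr' ?_
  filter_upwards [eventually_gt_atTop 0] with n hn
  have hn' : (0 : ℝ) < n := by exact_mod_cast hn
  have hnk : (n : ℝ) + k ≠ 0 := by positivity
  simp only [Function.comp_apply, Nat.cast_add]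
  field_simp

/-- Comparison of Birkhoff sums over `[w]` and `[w†]` with those of a periodic point through
`[w]` and its dual. -/
theorem birkhoff_sub_le_of_periodic {θ C : ℝ} (hθ0 : 0 < θ) (hθ1 : θ < 1)
    (hr : HolderWith θ C r)
    (hAdag : ∀ i j : W, A i j = true → A (dag j) (dag i) = true) {N : ℕ}
    (hpath : ∀ i j : W, ∃ u : ℕ → W,
      u 0 = i ∧ u (N + 1) = j ∧ ∀ t, t < N + 1 → A (u t) (u (t + 1)) = true)
    {β : ℕ → ℝ} (hβ0 : ∀ n, 0 ≤ β n)
    (hβ : ∀ n : ℕ, 1 ≤ n → ∀ x : SftSpace A, shift^[n] x = x →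
      ∀ y : SftSpace A, shift^[n] y = y →
        (∀ i, i < n → y.1 i = dag (x.1 ((n - i) % n))) →
        |birkhoff r n x - birkhoff r n y| ≤ β n)
    {n : ℕ} {x y : SftSpace A} (hxy : ∀ i, i < n → y.1 i = dag (x.1 (n - 1 - i))) :
    birkhoff r n x - birkhoff r n y ≤ β (n + N) + (2 * (C / (1 - θ)) + N * C) := by
  have hC : 0 ≤ C := by simpa using hr 0 x x (by simp)
  have hK : 0 ≤ C / (1 - θ) := div_nonneg hC (by linarith)
  obtain _ | k := n
  · have := hβ0 (0 + N)
    simp only [birkhoff, Finset.range_zero, Finset.sum_empty, sub_zero]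
    positivity
  obtain ⟨v, hvw, hclosed, hv⟩ := exists_closed_path_extending hpath (w := x.1) (k := k)
    fun i _ => x.2 i
  obtain ⟨m, hm⟩ : ∃ m, m = k + 1 + N := ⟨_, rfl⟩
  rw [show k + (N + 1) = m by lia] at hv hclosed
  have hmpos : 0 < m := by lia
  obtain ⟨p, hp, hpv⟩ := exists_periodic_of_closed_path hmpos hv hclosed
  obtain ⟨q, hq, hqv⟩ := exists_periodic_of_closed_path (A := A) hmpos
    (v := fun t => dag (v (m - t)))
    (fun t ht => by
      have h := hAdag _ _ (hv (m - (t + 1)) (by lia))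
      rwa [show m - (t + 1) + 1 = m - t by lia] at h)
    (by simp [hclosed])
  have hpq : ∀ i, i < m → q.1 i = dag (p.1 ((m - i) % m)) := by
    intro i hi
    rw [hqv, hpv, Nat.mod_mod, Nat.mod_eq_of_lt hi]
    rcases i.eq_zero_or_pos with rfl | hi0
    · simp [hclosed]
    · rw [Nat.mod_eq_of_lt (by lia : m - i < m)]
  have hxp : ∀ i, i < k + 1 → x.1 i = p.1 i := fun i hi => by
    rw [hpv, Nat.mod_eq_of_lt (by lia), hvw i (by lia)]
  have hyq : ∀ i, i < k + 1 → (shift^[N + 1] q).1 i = y.1 i := fun i hi => by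
    rw [shift_iterate_apply, hxy i hi, ← hvw _ (by lia), hqv]
    rcases Nat.lt_or_ge (i + (N + 1)) m with h | h
    · rw [Nat.mod_eq_of_lt h]
      congr 2
      lia
    · rw [show i + (N + 1) = m by lia, show k + 1 - 1 - i = 0 by lia, Nat.mod_self]
      simp [hclosed]
  have h1 := abs_le.1 (hr.abs_birkhoff_sub_le hθ0 hθ1 hxp)
  have h2 := abs_le.1 (hr.abs_birkhoff_sub_le hθ0 hθ1 hyq)
  have h3 := abs_le.1 (hβ m hmpos p hp q hq hpq)
  have h4 := abs_le.1 (hr.abs_birkhoff_sub_le_mul N (shift^[k + 1] p)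
    (shift^[k + 1] (shift^[N + 1] q)))
  rw [← birkhoff_shift_iterate_of_periodic r hq (N + 1), hm,
    birkhoff_add r (k + 1), birkhoff_add r (k + 1)] at h3
  linarith [h1.2, h2.2, h3.2, h4.1]

end WeakSymmetry

/-- An involution `†` of the alphabet (compatible with the transition matrix)
is weakly symmetric with respect to `r` if and only if there are `β(n) ≥ 0` with `β(n)/n → 0`
such that `|rⁿ(x) − rⁿ(x†)| ≤ β(n)` for every `n ≥ 1` and every `n`-periodic point `x`, where
`(x†)_i = (x_{(n−i) mod n})†`. -/
theorem statement9 {W : Type*} [Fintype W]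
    (A : W → W → Bool) (hmix : Aperiodic A)
    (θ C : ℝ) (hθ0 : 0 < θ) (hθ1 : θ < 1)
    (r : SftSpace A → ℝ) (hr : HolderWith θ C r)
    (dag : W → W) (hinv : Function.Involutive dag)
    (hAdag : ∀ i j : W, A i j = true → A (dag j) (dag i) = true) :
    (∃ D : ℕ → ℝ, (∀ n, 0 < D n) ∧
        Tendsto (fun n : ℕ => D n ^ ((n : ℝ)⁻¹)) atTop (nhds 1) ∧
        DaggerWeaklySymm dag r D) ↔
      ∃ β : ℕ → ℝ, (∀ n, 0 ≤ β n) ∧ Tendsto (fun n : ℕ => β n / n) atTop (nhds 0) ∧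
        ∀ n : ℕ, 1 ≤ n → ∀ x : SftSpace A, shift^[n] x = x →
          ∀ y : SftSpace A, shift^[n] y = y →
            (∀ i, i < n → y.1 i = dag (x.1 ((n - i) % n))) →
            |birkhoff r n x - birkhoff r n y| ≤ β n := by
  constructor
  · rintro ⟨D, hpos, hlim, hD⟩
    refine ⟨fun n => |Real.log (D n)|, fun n => abs_nonneg _, ?_, fun n hn x _ y hy hxy =>
      (hD.abs_birkhoff_sub_le hinv hn hy hxy).trans (le_abs_self _)⟩
    have h := (tendsto_log_div_of_tendsto_rpow_inv hpos hlim).abs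
    simpa only [abs_div, Nat.abs_cast, abs_zero] using h
  · rintro ⟨β, hβ0, hlim, hβ⟩
    obtain ⟨_ | N, hN, hpath⟩ := hmix
    · exact absurd hN (lt_irrefl 0)
    refine ⟨fun n => Real.exp (β (n + N) + (2 * (C / (1 - θ)) + N * C)),
      fun n => Real.exp_pos _,
      tendsto_exp_rpow_inv (tendsto_shift_add_const_div hlim N _), ?_⟩
    intro n w _ x y hxw hyw
    refine Real.exp_le_exp.2
      (birkhoff_sub_le_of_periodic hθ0 hθ1 hr hAdag hpath hβ0 hβ fun i hi => ?_)
    rw [hyw i hi, hxw _ (by lia)]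

end CriticalExponents
end
end
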